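/- Let U ⊆ ℂⁿ be open, let 1 ≤ d ≤ n and let k₁, …, k_d ≥ 1 be integers. Let φ be holomorphic on U and suppose that for each j ∈ {1, …, d} the function z ↦ z_j^{1−k_j} φ(z), defined on U ∖ {z_j = 0}, is locally square-integrable on U. Then the function z ↦ z₁^{1−k₁} ⋯ z_d^{1−k_d} φ(z), defined on U ∖ {z₁⋯z_d = 0}, extends to a holomorphic function on all of U; in particular it is locally square-integrable on U. -/

import Mathlib

open MeasureTheory

noncomputable section

open Metric Set Filter Topology

/-- A function that near `z₀` is the average of its translates along a circle in the direction `e`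
is holomorphic at `z₀` if it is holomorphic and bounded on an open set containing these circles. -/
theorem differentiableAt_of_eq_circleAverage_translate {E : Type*} [NormedAddCommGroup E]
    [NormedSpace ℂ E] [FiniteDimensional ℂ E] {h : E → ℂ} {V : Set E} (hV : IsOpen V)
    (hd : DifferentiableOn ℂ h V) {C : ℝ} (hC : ∀ w ∈ V, ‖h w‖ ≤ C) {z₀ e : E} {r ρ : ℝ}
    (hρ : 0 < ρ) (hmem : ∀ z ∈ ball z₀ ρ, ∀ θ, z + circleMap 0 r θ • e ∈ V)
    (havg : ∀ z ∈ ball z₀ ρ, h z = Real.circleAverage (fun t : ℂ => h (z + t • e)) 0 r) :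
    DifferentiableAt ℂ h z₀ := by
  borelize E
  have : CompleteSpace E := FiniteDimensional.complete ℂ E
  have : SecondCountableTopology E := by
    have := FiniteDimensional.proper ℂ E
    infer_instance
  have : SecondCountableTopology (E →L[ℂ] ℂ) := by
    have := FiniteDimensional.proper ℂ (E →L[ℂ] ℂ)
    infer_instance
  have hcont (z) (hz : z ∈ ball z₀ ρ) : Continuous fun θ => h (z + circleMap 0 r θ • e) :=
    hd.continuousOn.comp_continuous (by fun_prop) (hmem z hz)
  have hz₀ : z₀ ∈ ball z₀ ρ := mem_ball_self hρ
  have key := (hasFDerivAt_integral_of_dominated_loc_of_lip'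
    (μ := volume.restrict (Ioc 0 (2 * Real.pi))) (𝕜 := ℂ)
    (F := fun z θ => h (z + circleMap 0 r θ • e))
    (F' := fun θ => fderiv ℂ h (z₀ + circleMap 0 r θ • e))
    (bound := fun _ => 2 * C / ρ) (x₀ := z₀) (ball_mem_nhds z₀ hρ)
    (fun z hz => (hcont z hz).aestronglyMeasurable)
    (hcont z₀ hz₀).integrableOn_Ioc
    (((measurable_fderiv ℂ h).comp
      (by fun_prop : Continuous fun θ => z₀ + circleMap 0 r θ • e).measurable).aestronglyMeasurable)
    (ae_of_all _ fun θ z hz => ?_) (integrable_const _)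
    (ae_of_all _ fun θ => ?_)).2
  · have hev : h =ᶠ[𝓝 z₀] fun z => (2 * Real.pi)⁻¹ •
        ∫ θ in Ioc 0 (2 * Real.pi), h (z + circleMap 0 r θ • e) := by
      filter_upwards [ball_mem_nhds z₀ hρ] with z hz
      rw [havg z hz, Real.circleAverage_def, intervalIntegral.integral_of_le (by positivity)]
    exact ((key.differentiableAt.const_smul ((2 * Real.pi)⁻¹)).congr_of_eventuallyEq hev)
  · have := Complex.dist_le_div_mul_dist_of_mapsTo_ball (R₂ := 2 * C)
      (f := fun z => h (z + circleMap 0 r θ • e)) (c := z₀) (R₁ := ρ)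
      (hd.comp (by fun_prop) fun z hz => hmem z hz θ) (fun w hw => ?_) hz
    · simpa [dist_eq_norm] using this
    · rw [mem_closedBall, dist_eq_norm]
      calc _ ≤ _ := norm_sub_le _ _
        _ ≤ C + C := add_le_add (hC _ (hmem w hw θ)) (hC _ (hmem z₀ hz₀ θ))
        _ = 2 * C := by ring
  · exact (hasFDerivAt_comp_add_right _).2
      (hd.differentiableAt (hV.mem_nhds (hmem z₀ hz₀ θ))).hasFDerivAt

/-- A holomorphic function vanishing on the hyperplane `z j = 0` is divisible by `z j`. -/
theorem exists_eq_coord_mul_of_forall_coord_eq_zero {ι : Type*} [Fintype ι] [DecidableEq ι]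
    {U : Set (ι → ℂ)} (hU : IsOpen U) {g : (ι → ℂ) → ℂ} (hg : DifferentiableOn ℂ g U) (j : ι)
    (hz : ∀ z ∈ U, z j = 0 → g z = 0) :
    ∃ h : (ι → ℂ) → ℂ, DifferentiableOn ℂ h U ∧ ∀ z ∈ U, g z = z j * h z := by
  set h : (ι → ℂ) → ℂ := fun z =>
    if z j = 0 then deriv (fun t => g (Function.update z j t)) 0 else g z / z j with hh
  have hne (z : ι → ℂ) (h0 : z j ≠ 0) : h z = g z / z j := if_neg h0
  have hslope (z : ι → ℂ) (hu : Function.update z j 0 ∈ U) :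
      h z = dslope (fun t => g (Function.update z j t)) 0 (z j) := by
    by_cases h0 : z j = 0
    · simp [hh, h0]
    · simp [hne z h0, dslope_of_ne _ h0, slope_def_field, hz _ hu (by simp)]
  have hoff : DifferentiableOn ℂ h {z ∈ U | z j ≠ 0} := by
    refine DifferentiableOn.congr (f := fun z => g z * (z j)⁻¹) ?_ fun z hz =>
      (hne z hz.2).trans (div_eq_mul_inv _ _)
    exact (hg.mono fun z hz => hz.1).mul
      ((differentiable_apply j).differentiableOn.inv fun z hz => hz.2)
  have hopen : IsOpen {z ∈ U | z j ≠ 0} :=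
    hU.inter (isOpen_ne.preimage (continuous_apply j))
  refine ⟨h, fun z₀ hz₀ => DifferentiableAt.differentiableWithinAt ?_, fun z hzU => ?_⟩
  swap
  · by_cases h0 : z j = 0
    · simp [h0, hz z hzU h0]
    · rw [hne z h0]; field_simp
  by_cases h0 : z₀ j = 0
  swap
  · exact hoff.differentiableAt (hopen.mem_nhds ⟨hz₀, h0⟩)
  obtain ⟨R, hR, hRU⟩ := nhds_basis_closedBall.mem_iff.1 (hU.mem_nhds hz₀)
  obtain ⟨C, hC⟩ := (isCompact_closedBall z₀ R).exists_bound_of_continuousOn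
    (hg.continuousOn.mono hRU)
  set r := R / 3 with hr
  have hr0 : 0 < r := by positivity
  have hupd (z : ι → ℂ) (hzb : z ∈ ball z₀ r) (t : ℂ) (ht : ‖t‖ ≤ R) :
      Function.update z j t ∈ U := by
    refine hRU ((dist_pi_le_iff hR.le).2 fun i => ?_)
    rcases eq_or_ne i j with rfl | hi
    · simpa [h0] using ht
    · have := (dist_le_pi_dist z z₀ i).trans (mem_ball.1 hzb).le
      simp only [Function.update_of_ne hi]
      linarith
  have hcoord (z : ι → ℂ) (ρ : ℝ) (hzb : z ∈ ball z₀ ρ) : ‖z j‖ < ρ := by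
    have := (dist_le_pi_dist z z₀ j).trans_lt hzb
    simpa [h0] using this
  refine differentiableAt_of_eq_circleAverage_translate (ρ := r / 2) (r := r)
    (e := Pi.single j (1 : ℂ)) (C := C / (r / 2))
    (V := {z ∈ U | z j ≠ 0} ∩ {z | r / 2 < ‖z j‖} ∩ ball z₀ R)
    ((hopen.inter (isOpen_lt continuous_const (by fun_prop))).inter isOpen_ball)
    (hoff.mono fun z hz => hz.1.1) (fun w hw => ?_) (by positivity) (fun z hzb θ => ?_)
    (fun z hzb => ?_)
  · rw [hne w hw.1.1.2, norm_div]
    have hgw := hC w (ball_subset_closedBall hw.2)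
    exact div_le_div₀ ((norm_nonneg _).trans hgw) hgw (by positivity) hw.1.2.le
  · have hnc : ‖circleMap 0 r θ‖ = r := by simp [abs_of_pos hr0]
    have hlow : r / 2 < ‖(z + circleMap 0 r θ • Pi.single j (1 : ℂ) : ι → ℂ) j‖ := by
      have h1 := hcoord z _ hzb
      have h2 := norm_sub_le (z j + circleMap 0 r θ) (z j)
      rw [add_sub_cancel_left, hnc] at h2
      simp only [Pi.add_apply, Pi.smul_apply, Pi.single_eq_same, smul_eq_mul, mul_one]
      linarith
    have hball : z + circleMap 0 r θ • Pi.single j (1 : ℂ) ∈ ball z₀ R := by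
      rw [mem_ball, dist_eq_norm, add_sub_right_comm]
      refine (norm_add_le _ _).trans_lt ?_
      rw [norm_smul, hnc, Pi.norm_single, norm_one]
      rw [mem_ball, dist_eq_norm] at hzb
      linarith
    exact ⟨⟨⟨hRU (ball_subset_closedBall hball),
      norm_pos_iff.1 (lt_trans (by positivity) hlow)⟩, hlow⟩, hball⟩
  · have hzb' : z ∈ ball z₀ r := ball_subset_ball (by linarith) hzb
    have hdiff : DifferentiableOn ℂ (dslope (fun t => g (Function.update z j t)) 0) (ball 0 R) := by
      refine (Complex.differentiableOn_dslope (ball_mem_nhds 0 hR)).2 ?_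
      refine hg.comp (fun t _ => ?_) fun t ht => hupd z hzb' t (mem_ball_zero_iff.1 ht).le
      exact (hasFDerivAt_update z t).differentiableAt.differentiableWithinAt
    have hsub : closedBall (z j) |r| ⊆ ball 0 R := by
      intro t ht
      rw [abs_of_pos hr0, mem_closedBall, dist_eq_norm] at ht
      have h1 := hcoord z _ hzb
      have h2 := norm_add_le (t - z j) (z j)
      rw [sub_add_cancel] at h2
      rw [mem_ball_zero_iff]
      linarith
    rw [hslope z (hupd z hzb' 0 (by simpa using hR.le)),
      ← circleAverage_of_differentiable_on_off_countable countable_empty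
        (hdiff.continuousOn.mono hsub)
        fun t ht => hdiff.differentiableAt
          (isOpen_ball.mem_nhds (hsub (ball_subset_closedBall ht.1)))]
    simp only [Real.circleAverage_def]
    congr 2 with θ
    have hu (s : ℂ) : Function.update (z + circleMap 0 r θ • Pi.single j (1 : ℂ)) j s =
        Function.update z j s := by
      ext i
      rcases eq_or_ne i j with rfl | hi <;> simp [*]
    rw [hslope _ (by rw [hu]; exact hupd z hzb' 0 (by simpa using hR.le))]
    simp only [hu]
    simp [circleMap]

/-- If `f` is continuous and `f / z j` is dominated near `z j = 0` by a locally square-integrable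
function, then `f` vanishes on the hyperplane `z j = 0`. -/
theorem eq_zero_of_norm_le_norm_coord_mul_of_integrableOn_sq {ι : Type*} [Fintype ι]
    {U : Set (ι → ℂ)} (hU : IsOpen U) {f u : (ι → ℂ) → ℂ} (hf : ContinuousOn f U) (j : ι)
    (hfu : ∀ z ∈ U, z j ≠ 0 → ‖z j‖ ≤ 1 → ‖f z‖ ≤ ‖z j‖ * ‖u z‖)
    (hu : ∀ K ⊆ U, IsCompact K → IntegrableOn (fun z => ‖u z‖ ^ 2) K)
    {z₀ : ι → ℂ} (hz₀ : z₀ ∈ U) (h0 : z₀ j = 0) : f z₀ = 0 := by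
  classical
  by_contra hne
  set c := ‖f z₀‖ / 2 with hc
  have hc0 : 0 < c := by have := norm_pos_iff.2 hne; positivity
  have hnhds : U ∩ {z | c < ‖f z‖} ∈ 𝓝 z₀ := by
    refine inter_mem (hU.mem_nhds hz₀) ?_
    refine (hf.continuousAt (hU.mem_nhds hz₀)).norm.eventually (lt_mem_nhds ?_)
    linarith
  obtain ⟨R, hR, hRU⟩ := nhds_basis_closedBall.mem_iff.1 hnhds
  set r := min R 1 with hr
  have hr0 : 0 < r := by positivity
  have hKU : closedBall z₀ r ⊆ U ∩ {z | c < ‖f z‖} :=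
    (closedBall_subset_closedBall (min_le_left _ _)).trans hRU
  set S : ℝ → Set (ι → ℂ) := fun ε => univ.pi fun i =>
    if i = j then closedBall 0 ε \ {0} else closedBall (z₀ i) r with hS
  set D : ENNReal := NNReal.pi * ∏ i ∈ Finset.univ.erase j, volume (closedBall (z₀ i) r) with hD
  have hvol (ε : ℝ) : volume (S ε) = ENNReal.ofReal ε ^ 2 * D := by
    rw [hS, volume_pi_pi, ← Finset.mul_prod_erase _ _ (Finset.mem_univ j), if_pos rfl,
      measure_sdiff_null (measure_singleton _), Complex.volume_closedBall, hD, mul_assoc]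
    congr 2
    exact Finset.prod_congr rfl fun i hi => by rw [if_neg (Finset.ne_of_mem_erase hi)]
  have hD0 : D ≠ 0 := by
    refine mul_ne_zero (by simpa using NNReal.pi_pos.ne') (Finset.prod_ne_zero_iff.2 fun i _ => ?_)
    exact (measure_closedBall_pos _ _ hr0).ne'
  have hDtop : D ≠ ⊤ :=
    ENNReal.mul_ne_top ENNReal.coe_ne_top
      (ENNReal.prod_ne_top fun i _ => measure_closedBall_lt_top.ne)
  have hSK {ε : ℝ} (hε : ε ≤ r) : S ε ⊆ closedBall z₀ r := by
    intro z hz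
    refine (dist_pi_le_iff hr0.le).2 fun i => ?_
    have := hz i (mem_univ i)
    beta_reduce at this
    rcases eq_or_ne i j with rfl | hi
    · rw [if_pos rfl] at this
      rw [h0]
      exact (mem_closedBall.1 this.1).trans hε
    · rw [if_neg hi] at this
      exact this
  have hmeas (ε : ℝ) : MeasurableSet (S ε) := by
    refine MeasurableSet.univ_pi fun i => ?_
    split_ifs
    · exact measurableSet_closedBall.diff (measurableSet_singleton _)
    · exact measurableSet_closedBall
  have hint := hu _ (fun z hz => (hKU hz).1) (isCompact_closedBall z₀ r)
  have hlim : Tendsto (fun ε => volume.restrict (closedBall z₀ r) (S ε)) (𝓝[>] 0) (𝓝 0) := by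
    have : Tendsto (fun ε : ℝ => ENNReal.ofReal ε ^ 2 * D) (𝓝[>] 0) (𝓝 0) := by
      have h1 : Tendsto (fun ε : ℝ => ENNReal.ofReal ε ^ 2) (𝓝 0) (𝓝 0) := by
        have : Continuous fun ε : ℝ => ENNReal.ofReal ε ^ 2 :=
          (ENNReal.continuous_pow 2).comp ENNReal.continuous_ofReal
        simpa using this.tendsto 0
      simpa using (ENNReal.Tendsto.mul_const h1 (.inr hDtop)).mono_left nhdsWithin_le_nhds
    refine tendsto_of_tendsto_of_tendsto_of_le_of_le tendsto_const_nhds this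
      (fun _ => zero_le) fun ε => ?_
    exact (Measure.restrict_apply_le _ _).trans (hvol ε).le
  have hlim' := tendsto_setLIntegral_zero hint.2.ne hlim
  have hlow : ∀ᶠ ε in 𝓝[>] (0 : ℝ), ENNReal.ofReal (c ^ 2) * D ≤
      ∫⁻ z in S ε, ‖‖u z‖ ^ 2‖ₑ ∂(volume.restrict (closedBall z₀ r)) := by
    filter_upwards [Ioc_mem_nhdsGT hr0] with ε hε
    rw [Measure.restrict_restrict (hmeas ε), inter_eq_left.2 (hSK hε.2)]
    calc ENNReal.ofReal (c ^ 2) * D = ENNReal.ofReal ((c / ε) ^ 2) * volume (S ε) := by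
          rw [hvol, ← mul_assoc (ENNReal.ofReal _) _ D, ← ENNReal.ofReal_pow hε.1.le,
            ← ENNReal.ofReal_mul (by positivity), ← mul_pow, div_mul_cancel₀ _ hε.1.ne']
      _ = ∫⁻ _ in S ε, ENNReal.ofReal ((c / ε) ^ 2) := (setLIntegral_const _ _).symm
      _ ≤ _ := by
          refine setLIntegral_mono' (hmeas ε) fun z hz => ?_
          have hzK := hKU (hSK hε.2 hz)
          have hzj := hz j (mem_univ j)
          beta_reduce at hzj
          rw [if_pos rfl] at hzj
          have hzε : ‖z j‖ ≤ ε := by simpa using hzj.1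
          have h1 := hfu z hzK.1 hzj.2 (hzε.trans (hε.2.trans (min_le_right _ _)))
          have h2 : c / ε ≤ ‖u z‖ := by
            rw [div_le_iff₀' hε.1]
            calc c ≤ ‖f z‖ := hzK.2.le
              _ ≤ _ := h1
              _ ≤ _ := by gcongr
          rw [← ofReal_norm, norm_pow, norm_norm]
          have := hε.1
          gcongr
  have := ge_of_tendsto hlim' hlow
  rw [nonpos_iff_eq_zero, mul_eq_zero] at this
  rcases this with h | h
  · rw [ENNReal.ofReal_eq_zero] at h
    nlinarith
  · exact hD0 h

/-- If `φ` is holomorphic and `z j ^ (-m) * φ` is locally square-integrable, then `φ` is divisible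
by `z j ^ m`. -/
theorem exists_eq_coord_pow_mul_of_integrableOn_sq {ι : Type*} [Fintype ι] [DecidableEq ι]
    {U : Set (ι → ℂ)} (hU : IsOpen U) {φ : (ι → ℂ) → ℂ} (hφ : DifferentiableOn ℂ φ U) (j : ι)
    (m : ℕ) (hL2 : ∀ K ⊆ U, IsCompact K →
      IntegrableOn (fun z : ι → ℂ => ‖(z j) ^ (-(m : ℤ)) * φ z‖ ^ 2) K) :
    ∃ g : (ι → ℂ) → ℂ, DifferentiableOn ℂ g U ∧ ∀ z ∈ U, φ z = z j ^ m * g z := by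
  suffices ∀ a ≤ m, ∃ g : (ι → ℂ) → ℂ, DifferentiableOn ℂ g U ∧ ∀ z ∈ U, φ z = z j ^ a * g z from
    this m le_rfl
  intro a
  induction a with
  | zero => exact fun _ => ⟨φ, hφ, by simp⟩
  | succ a ih =>
    intro ha
    obtain ⟨g, hg, hφg⟩ := ih (by omega)
    have hbound (w : ι → ℂ) (hw : w ∈ U) (hwj : w j ≠ 0) (hw1 : ‖w j‖ ≤ 1) :
        ‖g w‖ ≤ ‖w j‖ * ‖w j ^ (-(m : ℤ)) * φ w‖ := by
      obtain ⟨b, rfl⟩ := Nat.exists_eq_add_of_lt ha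
      have h0 : 0 < ‖w j‖ := norm_pos_iff.2 hwj
      have hpow : ‖w j‖ ^ b ≤ 1 := pow_le_one₀ h0.le hw1
      have heq : ‖w j‖ * ‖w j ^ (-((a + b + 1 : ℕ) : ℤ)) * φ w‖ * ‖w j‖ ^ b = ‖g w‖ := by
        rw [hφg w hw, norm_mul, norm_mul, norm_zpow, norm_pow, zpow_neg, zpow_natCast]
        field_simp
        ring
      rw [← heq]
      exact mul_le_of_le_one_right (by positivity) hpow
    obtain ⟨h, hh, hgh⟩ := exists_eq_coord_mul_of_forall_coord_eq_zero hU hg j fun z hz hzj =>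
      eq_zero_of_norm_le_norm_coord_mul_of_integrableOn_sq hU hg.continuousOn j hbound hL2 hz hzj
    exact ⟨h, hh, fun z hz => by rw [hφg z hz, hgh z hz]; ring⟩

theorem eventually_coord_add_smul_ne_zero {ι : Type*} (z : ι → ℂ) {v : ι → ℂ} {i : ι}
    (hv : v i ≠ 0) : ∀ᶠ t in 𝓝[≠] (0 : ℂ), (z + t • v) i ≠ 0 := by
  by_cases hzi : z i = 0
  · filter_upwards [self_mem_nhdsWithin] with t ht
    simpa [hzi, hv] using ht
  · have hc : ContinuousAt (fun t : ℂ => (z + t • v) i) 0 := by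
      simp only [Pi.add_apply, Pi.smul_apply]
      fun_prop
    exact (hc.eventually_ne (by simpa using hzi)).filter_mono nhdsWithin_le_nhds

theorem eq_zero_of_eventually_add_smul_eq_zero {E : Type*} [NormedAddCommGroup E]
    [NormedSpace ℂ E] {U : Set E} (hU : IsOpen U) {F : E → ℂ} (hF : ContinuousOn F U) {z : E}
    (hz : z ∈ U) (v : E) (h : ∀ᶠ t in 𝓝[≠] (0 : ℂ), z + t • v ∈ U → F (z + t • v) = 0) :
    F z = 0 := by
  have hline : Tendsto (fun t : ℂ => z + t • v) (𝓝[≠] 0) (𝓝 z) := by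
    have : Continuous fun t : ℂ => z + t • v := by fun_prop
    simpa using (this.tendsto 0).mono_left nhdsWithin_le_nhds
  refine tendsto_nhds_unique (((hF.continuousAt (hU.mem_nhds hz)).tendsto.comp hline).congr' ?_)
    tendsto_const_nhds
  filter_upwards [h, hline.eventually (hU.mem_nhds hz)] with t ht htU using ht htU

/-- Monomials in the other coordinates can be cancelled in a divisibility by `z j ^ a`. -/
theorem exists_eq_coord_pow_mul_of_prod_mul_eq {ι : Type*} [Fintype ι] [DecidableEq ι]
    {U : Set (ι → ℂ)} (hU : IsOpen U) {s : Finset ι} {j : ι} (hj : j ∉ s) (m : ι → ℕ) (a : ℕ)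
    {g h : (ι → ℂ) → ℂ} (hg : DifferentiableOn ℂ g U) (hh : ContinuousOn h U)
    (hgh : ∀ z ∈ U, (∏ i ∈ s, z i ^ m i) * g z = z j ^ a * h z) :
    ∃ q : (ι → ℂ) → ℂ, DifferentiableOn ℂ q U ∧ ∀ z ∈ U, g z = z j ^ a * q z := by
  induction a generalizing g with
  | zero => exact ⟨g, hg, by simp⟩
  | succ a ih =>
    obtain ⟨p, hp, hgp⟩ := exists_eq_coord_mul_of_forall_coord_eq_zero hU hg j fun z hz hzj => by
      refine eq_zero_of_eventually_add_smul_eq_zero hU hg.continuousOn hz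
        (Function.update 1 j 0) ?_
      have hs : ∀ᶠ t in 𝓝[≠] (0 : ℂ), 
          ∀ i ∈ s, (z + t • Function.update (1 : ι → ℂ) j 0) i ≠ 0 :=
        (Finset.eventually_all s).2 fun i hi => eventually_coord_add_smul_ne_zero z (by
          rw [Function.update_of_ne (ne_of_mem_of_not_mem hi hj)]
          exact one_ne_zero)
      filter_upwards [hs] with t ht htU
      have := hgh _ htU
      have hzero : (z + t • Function.update (1 : ι → ℂ) j 0) j = 0 := by simp [hzj]
      rw [hzero, zero_pow a.succ_ne_zero, zero_mul] at this
      exact (mul_eq_zero.1 this).resolve_left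
        (Finset.prod_ne_zero_iff.2 fun i hi => pow_ne_zero _ (ht i hi))
    obtain ⟨q, hq, hpq⟩ := ih hp fun z hz => by
      rw [← sub_eq_zero]
      refine eq_zero_of_eventually_add_smul_eq_zero hU
        (F := fun z => (∏ i ∈ s, z i ^ m i) * p z - z j ^ a * h z) ?_ hz (Pi.single j 1) ?_
      · have := hp.continuousOn
        fun_prop
      · filter_upwards [eventually_coord_add_smul_ne_zero z
          (by simp : (Pi.single j 1 : ι → ℂ) j ≠ 0)] with t ht htU
        have := hgh _ htU
        rw [hgp _ htU] at this
        refine mul_left_cancel₀ ht ?_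
        linear_combination this
    exact ⟨q, hq, fun z hz => by rw [hgp z hz, hpq z hz]; ring⟩

/-- A holomorphic function divisible by each `z j ^ m j`, `j ∈ s`, is divisible by their product. -/
theorem exists_eq_prod_coord_pow_mul {ι : Type*} [Fintype ι] [DecidableEq ι]
    {U : Set (ι → ℂ)} (hU : IsOpen U) {φ : (ι → ℂ) → ℂ} (hφ : DifferentiableOn ℂ φ U)
    (s : Finset ι) (m : ι → ℕ)
    (h : ∀ j ∈ s, ∃ g : (ι → ℂ) → ℂ, DifferentiableOn ℂ g U ∧ ∀ z ∈ U, φ z = z j ^ m j * g z) :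
    ∃ g : (ι → ℂ) → ℂ, DifferentiableOn ℂ g U ∧ ∀ z ∈ U, φ z = (∏ j ∈ s, z j ^ m j) * g z := by
  induction s using Finset.induction_on with
  | empty => exact ⟨φ, hφ, by simp⟩
  | insert j s hj ih =>
    obtain ⟨g, hg, hφg⟩ := ih fun i hi => h i (Finset.mem_insert_of_mem hi)
    obtain ⟨p, hp, hφp⟩ := h j (Finset.mem_insert_self j s)
    obtain ⟨q, hq, hgq⟩ := exists_eq_coord_pow_mul_of_prod_mul_eq hU hj m (m j) hg hp.continuousOn
      fun z hz => by rw [← hφg z hz, hφp z hz]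
    exact ⟨q, hq, fun z hz => by rw [hφg z hz, hgq z hz, Finset.prod_insert hj]; ring⟩

/-- **Holomorphic extension of `z₁^{1−k₁} ⋯ z_d^{1−k_d} φ` across a normal crossing.**
Let `U ⊆ ℂⁿ` be open, `1 ≤ d ≤ n`, `k_j ≥ 1`, and `φ` holomorphic on `U`. If for each
`j < d` the function `z ↦ z_j^{1−k_j} φ(z)` is locally square-integrable on `U`, then
`z ↦ z₁^{1−k₁} ⋯ z_d^{1−k_d} φ(z)` extends to a holomorphic function on `U`; in
particular it is locally square-integrable on `U`. -/
theorem holomorphic_extension_normal_crossing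
    {n : ℕ} (U : Set (Fin n → ℂ)) (hU : IsOpen U)
    (d : ℕ) (hd1 : 1 ≤ d) (hdn : d ≤ n)
    (k : Fin n → ℕ) (hk : ∀ j : Fin n, (j : ℕ) < d → 1 ≤ k j)
    (φ : (Fin n → ℂ) → ℂ) (hφ : DifferentiableOn ℂ φ U)
    (hL2 : ∀ j : Fin n, (j : ℕ) < d → ∀ K ⊆ U, IsCompact K →
      IntegrableOn (fun z : Fin n → ℂ => ‖(z j) ^ (1 - (k j : ℤ)) * φ z‖ ^ 2) K) :
    ∃ Φ : (Fin n → ℂ) → ℂ, DifferentiableOn ℂ Φ U ∧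
      (∀ z ∈ U, (∀ j : Fin n, (j : ℕ) < d → z j ≠ 0) →
        Φ z = (∏ j ∈ Finset.univ.filter (fun j : Fin n => (j : ℕ) < d),
          (z j) ^ (1 - (k j : ℤ))) * φ z) ∧
      (∀ K ⊆ U, IsCompact K → IntegrableOn (fun z => ‖Φ z‖ ^ 2) K) := by
  have hexp (j : Fin n) (hj : (j : ℕ) < d) : 1 - (k j : ℤ) = -((k j - 1 : ℕ) : ℤ) := by
    have := hk j hj
    omega
  obtain ⟨Φ, hΦ, hφΦ⟩ := exists_eq_prod_coord_pow_mul hU hφ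
    (Finset.univ.filter fun j : Fin n => (j : ℕ) < d) (fun j => k j - 1) fun j hj => by
      have hjd := (Finset.mem_filter.1 hj).2
      refine exists_eq_coord_pow_mul_of_integrableOn_sq hU hφ j _ ?_
      rw [← hexp j hjd]
      exact hL2 j hjd
  refine ⟨Φ, hΦ, fun z hz hz0 => ?_, fun K hKU hK =>
    ((hΦ.continuousOn.mono hKU).norm.pow 2).integrableOn_compact hK⟩
  rw [hφΦ z hz, ← mul_assoc, ← Finset.prod_mul_distrib, Finset.prod_eq_one, one_mul]
  intro j hj
  have hjd := (Finset.mem_filter.1 hj).2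
  rw [hexp j hjd, zpow_neg, zpow_natCast, inv_mul_cancel₀ (pow_ne_zero _ (hz0 j hjd))]
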